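/- Let p be a depth-zero pattern of the form r q r (beginning and ending with r) whose only bifix is the single letter r, and suppose p has dimensions (b+1)×d (b ≥ 1). Then for every n ≥ 1 the number of Dyck paths of semilength n avoiding p satisfies, in ℚ: s_p(n, n) = Σ_{i ≥ 0, b·i ≤ n−1} (−1)^i · (1/(n − d·i + 1)) · C(n − (b−1)i − 1, i) · C(2n − (d+b)i, n − b·i). -/

import Mathlib

/-- A step of a lattice path: `u` (up) or `r` (right). -/
inductive Step : Type
  | u : Step
  | r : Step
deriving DecidableEq

/-- A word over the alphabet `{u, r}`. -/
abbrev Word := List Step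

/-- The number of letters `r` in a word. -/
def countR (w : Word) : ℕ := w.count Step.r

/-- The number of letters `u` in a word. -/
def countU (w : Word) : ℕ := w.count Step.u

/-- `dval q` = (number of `r`'s in `q`) - (number of `u`'s in `q`). -/
def dval (w : Word) : ℤ := (countR w : ℤ) - (countU w : ℤ)

/-- A pattern is depth-zero if every suffix `q` of it satisfies `dval q ≥ 0`. -/
def DepthZero (p : Word) : Prop := ∀ q : Word, q <:+ p → 0 ≤ dval q

/-- `o` is a bifix of `p`: a nonempty proper prefix of `p` that is also a (proper) suffix. -/
def IsBifix (o p : Word) : Prop := o ≠ [] ∧ o ≠ p ∧ o <+: p ∧ o <:+ p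

/-- A pattern is bifix-free if it has no bifix. -/
def BifixFree (p : Word) : Prop := ∀ o : Word, ¬ IsBifix o p

/-- `w` is a ballot path to the lattice point `(n, m)`: it has exactly `n` letters `r`
and `m` letters `u`, and every prefix has at least as many `u`'s as `r`'s. -/
def IsBallot (w : Word) (n m : ℤ) : Prop :=
  (countR w : ℤ) = n ∧ (countU w : ℤ) = m ∧
    ∀ t : Word, t <+: w → countR t ≤ countU t

/-- `w` avoids the pattern `p`: `p` does not occur in `w` as a contiguous substring. -/
def Avoids (p w : Word) : Prop := ¬ p <:+: w

/-- `s p n m` is the number of ballot paths to `(n, m)` avoiding `p`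
(`0` if `n < 0`, `m < 0`, or `m < n`, since then no such path exists). -/
noncomputable def s (p : Word) (n m : ℤ) : ℕ :=
  Set.ncard {w : Word | IsBallot w n m ∧ Avoids p w}

instance : Finite Step := Finite.of_injective (fun x : Step => decide (x = Step.u)) (by
  intro x y h
  cases x <;> cases y <;> simp_all)

/-- Ballot paths to `(n, m)` avoiding `p`. -/
def ballotAvoiding (p : Word) (n m : ℤ) : Set Word :=
  {w | IsBallot w n m ∧ Avoids p w}

/-- Ballot paths to `(n, m)` avoiding `p` whose last letter is `r`. -/
def ballotAvoidingR (p : Word) (n m : ℤ) : Set Word :=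
  {w | w ∈ ballotAvoiding p n m ∧ [Step.r] <:+ w}

lemma length_eq_countR_add_countU (w : Word) : w.length = countR w + countU w := by
  induction w with
  | nil => rfl
  | cons x w ih => cases x <;> simp_all [countR, countU] <;> omega

lemma countR_append (v w : Word) : countR (v ++ w) = countR v + countR w := List.count_append

lemma countU_append (v w : Word) : countU (v ++ w) = countU v + countU w := List.count_append

lemma finite_ballotAvoiding (p : Word) (n m : ℤ) : (ballotAvoiding p n m).Finite := by
  refine (List.finite_length_eq Step (n + m).toNat).subset ?_
  rintro w ⟨⟨h1, h2, -⟩, -⟩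
  have := length_eq_countR_add_countU w
  simp only [Set.mem_ofPred_eq]
  omega

lemma finite_ballotAvoidingR (p : Word) (n m : ℤ) : (ballotAvoidingR p n m).Finite :=
  (finite_ballotAvoiding p n m).subset fun _ h => h.1

lemma IsBallot.of_append {v w : Word} {n m : ℤ} (h : IsBallot (v ++ w) n m) :
    IsBallot v (n - countR w) (m - countU w) := by
  obtain ⟨h1, h2, h3⟩ := h
  rw [countR_append] at h1
  rw [countU_append] at h2
  push_cast at h1 h2
  exact ⟨by omega, by omega, fun t ht => h3 t (ht.trans (List.prefix_append v w))⟩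

lemma IsBallot.append_singleton {w : Word} {n m : ℤ} (h : IsBallot w n m) (x : Step)
    (hx : n + countR [x] ≤ m + countU [x]) :
    IsBallot (w ++ [x]) (n + countR [x]) (m + countU [x]) := by
  obtain ⟨h1, h2, h3⟩ := h
  refine ⟨by rw [countR_append]; push_cast; omega, by rw [countU_append]; push_cast; omega, ?_⟩
  intro t ht
  rcases List.prefix_concat_iff.1 ht with rfl | ht
  · rw [countR_append, countU_append]; omega
  · exact h3 t ht

lemma IsBallot.le {w : Word} {n m : ℤ} (h : IsBallot w n m) : n ≤ m := by
  obtain ⟨h1, h2, h3⟩ := h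
  have := h3 w List.prefix_rfl
  omega

lemma Avoids.of_append {p v w : Word} (h : Avoids p (v ++ w)) : Avoids p v :=
  fun hp => h (hp.trans (List.prefix_append v w).isInfix)

lemma avoids_append_singleton {p w : Word} {x : Step} :
    Avoids p (w ++ [x]) ↔ Avoids p w ∧ ¬ p <:+ w ++ [x] := by
  rw [Avoids, Avoids, List.infix_concat_iff]
  tauto

lemma s_eq_zero_of_lt (p : Word) {n m : ℤ} (h : m < n) : s p n m = 0 := by
  have : {w : Word | IsBallot w n m ∧ Avoids p w} = ∅ :=
    Set.eq_empty_of_forall_notMem fun w hw => absurd hw.1.le (by omega)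
  rw [s, this, Set.ncard_empty]

lemma eq_replicate_of_countR_eq_zero {w : Word} (h : countR w = 0) :
    w = List.replicate (countU w) Step.u := by
  induction w with
  | nil => rfl
  | cons x w ih =>
    cases x with
    | u =>
      have hw : countU (Step.u :: w) = countU w + 1 := by simp [countU]
      rw [hw, List.replicate_succ, ← ih (by simpa [countR] using h)]
    | r => simp [countR] at h

lemma s_zero_left {p : Word} (hp : countR p ≠ 0) (m : ℕ) : s p 0 m = 1 := by
  have : {w : Word | IsBallot w 0 m ∧ Avoids p w} = {List.replicate m Step.u} := by
    ext w
    simp only [Set.mem_ofPred_eq, Set.mem_singleton_iff]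
    constructor
    · rintro ⟨⟨h1, h2, -⟩, -⟩
      have := eq_replicate_of_countR_eq_zero (w := w) (by omega)
      rwa [show countU w = m by omega] at this
    · rintro rfl
      have h0 : countR (List.replicate m Step.u) = 0 := by simp [countR, List.count_replicate]
      refine ⟨⟨by simp [h0], by simp [countU], fun t ht => ?_⟩, fun hi => hp ?_⟩
      · have : countR t ≤ countR (List.replicate m Step.u) := ht.sublist.count_le _
        omega
      · have : countR p ≤ countR (List.replicate m Step.u) := hi.sublist.count_le _
        omega
  rw [s, this, Set.ncard_singleton]

lemma ballotAvoidingR_eq_empty (p : Word) {n m : ℤ} (hn : n ≤ 0) :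
    ballotAvoidingR p n m = ∅ := by
  refine Set.eq_empty_of_forall_notMem ?_
  rintro _ ⟨⟨⟨h1, -⟩, -⟩, ⟨v, rfl⟩⟩
  rw [countR_append] at h1
  simp [countR] at h1
  omega

/-- Splitting by the last letter. -/
lemma s_eq_add_ncard_ballotAvoidingR {p q : Word} (hp : p = Step.r :: (q ++ [Step.r])) {n m : ℤ}
    (hn : 1 ≤ n) (hnm : n ≤ m) :
    s p n m = s p n (m - 1) + (ballotAvoidingR p n m).ncard := by
  have hu : ∀ w : Word, ¬ p <:+ w ++ [Step.u] := by
    rintro w ⟨t, ht⟩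
    rw [hp] at ht
    rw [← List.cons_append, ← List.append_assoc] at ht
    simpa using List.append_inj_right' ht rfl
  have hset : ballotAvoiding p n m =
      (fun w : Word => w ++ [Step.u]) '' ballotAvoiding p n (m - 1) ∪ ballotAvoidingR p n m := by
    ext w
    constructor
    · intro hw
      rcases List.eq_nil_or_concat w with rfl | ⟨v, x, rfl⟩
      · have := hw.1.1
        simp [countR] at this
        omega
      · simp only [List.concat_eq_append] at hw ⊢
        cases x with
        | u =>
          refine Or.inl ⟨v, ⟨?_, hw.2.of_append⟩, rfl⟩
          simpa [countR, countU] using hw.1.of_append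
        | r => exact Or.inr ⟨hw, List.suffix_append v _⟩
    · rintro (⟨v, hv, rfl⟩ | hw)
      · refine ⟨?_, avoids_append_singleton.2 ⟨hv.2, hu v⟩⟩
        simpa [countR, countU] using
          hv.1.append_singleton Step.u (by simpa [countR, countU] using hnm)
      · exact hw.1
  have hdisj : Disjoint ((fun w : Word => w ++ [Step.u]) '' ballotAvoiding p n (m - 1))
      (ballotAvoidingR p n m) := by
    rw [Set.disjoint_left]
    rintro _ ⟨v, -, rfl⟩ ⟨-, ⟨t, ht⟩⟩
    simpa using congrArg List.getLast? ht
  change (ballotAvoiding p n m).ncard = (ballotAvoiding p n (m - 1)).ncard + _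
  rw [hset, Set.ncard_union_eq hdisj ((finite_ballotAvoiding _ _ _).image _)
    (finite_ballotAvoidingR _ _ _), Set.ncard_image_of_injective _ (List.append_left_injective _)]

lemma avoids_append_of_unique_bifix {p q v : Word} (hp : p = Step.r :: (q ++ [Step.r]))
    (huniq : ∀ o : Word, IsBifix o p → o = [Step.r]) (hv : Avoids p v) (hr : [Step.r] <:+ v) :
    Avoids p (v ++ q) := by
  obtain ⟨x, rfl⟩ := hr
  rintro ⟨a, c, h⟩
  have hlen := congrArg List.length h
  simp only [hp, List.length_append, List.length_cons, List.length_nil] at hlen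
  rcases List.append_eq_append_iff.1 h with ⟨y, hy, -⟩ | ⟨y, hy, hc⟩
  · exact hv ⟨a, y, hy.symm⟩
  · obtain ⟨x', rfl⟩ : a <+: x := by
      have h1 : a <+: x ++ [Step.r] ++ q := ⟨p ++ c, by rw [← h]; simp⟩
      have h2 : x <+: x ++ [Step.r] ++ q := ⟨[Step.r] ++ q, by simp⟩
      exact List.prefix_of_prefix_length_le h1 h2 (by omega)
    have hpx : p = x' ++ ([Step.r] ++ y) := by
      have : a ++ p = a ++ (x' ++ ([Step.r] ++ y)) := by rw [hy]; simp
      exact List.append_cancel_left this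
    have hy0 : y ≠ [] := by
      rintro rfl
      exact hv ⟨a, [], by rw [hpx]; simp⟩
    have hlen2 := congrArg List.length hc
    have hlen3 := congrArg List.length hp
    simp only [List.length_append, List.length_cons, List.length_nil] at hlen hlen2 hlen3
    have := huniq ([Step.r] ++ y) ⟨by simp, fun he => ?_, ⟨c ++ [Step.r], by rw [hp, hc]; simp⟩,
      ⟨x', hpx.symm⟩⟩
    · simp [hy0] at this
    · have := congrArg List.length he
      simp only [List.length_append, List.length_cons, List.length_nil] at this
      omega

/-- Appending `r` to an avoiding path either keeps it avoiding or completes an occurrence of `p`. -/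
lemma s_eq_ncard_ballotAvoidingR_add {p q : Word} (hp : p = Step.r :: (q ++ [Step.r]))
    (hdz : DepthZero p) (huniq : ∀ o : Word, IsBifix o p → o = [Step.r]) {b d : ℕ}
    (hR : countR p = b + 1) (hU : countU p = d) {n m : ℤ} (hnm : n ≤ m) :
    s p (n - 1) m = (ballotAvoidingR p n m).ncard + (ballotAvoidingR p (n - b) (m - d)).ncard := by
  have hqR : countR (q ++ [Step.r]) = b := by simp [hp, countR] at hR ⊢; omega
  have hqU : countU (q ++ [Step.r]) = d := by simp [hp, countU] at hU ⊢; omega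
  have hqR' : (countR q : ℤ) = b - 1 := by simp [countR] at hqR ⊢; omega
  have hqU' : countU q = d := by simp [countU] at hqU ⊢; omega
  set A : Set Word := {w | w ∈ ballotAvoiding p (n - 1) m ∧ ¬ p <:+ w ++ [Step.r]}
  have hset : ballotAvoiding p (n - 1) m =
      A ∪ (fun v : Word => v ++ q) '' ballotAvoidingR p (n - b) (m - d) := by
    ext w
    constructor
    · intro hw
      by_cases hs : p <:+ w ++ [Step.r]
      · obtain ⟨x, hx⟩ := hs
        have hx : x ++ [Step.r] ++ q = w := by
          refine List.append_cancel_right (bs := [Step.r]) ?_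
          rw [← hx, hp]
          simp
        subst hx
        refine Or.inr ⟨x ++ [Step.r], ⟨⟨?_, hw.2.of_append⟩, List.suffix_append x _⟩, rfl⟩
        have := hw.1.of_append
        rwa [hqR', hqU', show n - 1 - ((b : ℤ) - 1) = n - b by ring] at this
      · exact Or.inl ⟨hw, hs⟩
    · rintro (hw | ⟨v, ⟨⟨⟨h1, h2, h3⟩, hv⟩, hr⟩, rfl⟩)
      · exact hw.1
      · refine ⟨⟨?_, ?_, ?_⟩, avoids_append_of_unique_bifix hp huniq hv hr⟩
        · rw [countR_append]; push_cast; omega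
        · rw [countU_append]; push_cast; omega
        · intro t ht
          obtain ⟨z, hvz⟩ := ht
          rcases List.append_eq_append_iff.1 hvz with ⟨y, hy, -⟩ | ⟨y, rfl, hz⟩
          · exact h3 t ⟨y, hy.symm⟩
          · have hsuf := hdz (z ++ [Step.r]) ⟨Step.r :: y, by rw [hp, hz]; simp⟩
            rw [hz, List.append_assoc, countR_append] at hqR
            rw [hz, List.append_assoc, countU_append] at hqU
            rw [dval] at hsuf
            rw [countR_append, countU_append]
            omega
  have hAR : ballotAvoidingR p n m = (fun v : Word => v ++ [Step.r]) '' A := by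
    ext w
    constructor
    · rintro ⟨hw, ⟨v, rfl⟩⟩
      refine ⟨v, ⟨⟨?_, hw.2.of_append⟩, (avoids_append_singleton.1 hw.2).2⟩, rfl⟩
      simpa [countR, countU] using hw.1.of_append
    · rintro ⟨v, ⟨hv, hs⟩, rfl⟩
      refine ⟨⟨?_, avoids_append_singleton.2 ⟨hv.2, hs⟩⟩, List.suffix_append v _⟩
      simpa [countR, countU] using
        hv.1.append_singleton Step.r (by simpa [countR, countU] using hnm)
  have hdisj : Disjoint A ((fun v : Word => v ++ q) '' ballotAvoidingR p (n - b) (m - d)) := by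
    rw [Set.disjoint_left]
    rintro _ ⟨-, hs⟩ ⟨_, ⟨-, ⟨x, rfl⟩⟩, rfl⟩
    exact hs ⟨x, by rw [hp]; simp⟩
  change (ballotAvoiding p (n - 1) m).ncard = _
  rw [hset, Set.ncard_union_eq hdisj ((finite_ballotAvoiding _ _ _).subset fun _ h => h.1)
    ((finite_ballotAvoidingR _ _ _).image _), hAR,
    Set.ncard_image_of_injective _ (List.append_left_injective _),
    Set.ncard_image_of_injective _ (List.append_left_injective _)]

/-- The `i`-th summand of the closed formula for the number of avoiding ballot paths. -/
def formulaTerm (b d n m i : ℕ) : ℚ :=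
  (-1 : ℚ) ^ i * (((m : ℚ) - n + 1) / ((m : ℚ) - d * i + 1)) *
    (Nat.choose (n - (b - 1) * i - 1) i : ℚ) *
    (Nat.choose (n + m - (d + b) * i) (n - b * i) : ℚ)

/-- The closed formula for the number of avoiding ballot paths to `(n, m)`, for `1 ≤ n`. -/
def formula (b d K n m : ℕ) : ℚ :=
  ∑ i ∈ Finset.range K, if b * i < n then formulaTerm b d n m i else 0

lemma formulaTerm_eq (c d N U i n m : ℕ) (hn : n = N + (c + 1) * i) (hm : m = U + d * i) :
    formulaTerm (c + 1) d n m i = (-1 : ℚ) ^ i *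
      (((U : ℚ) + d * i - (N + (c + 1) * i) + 1) / (U + 1)) *
      (Nat.choose (N + i - 1) i : ℚ) * (Nat.choose (N + U) N : ℚ) := by
  have e1 : n - (c + 1 - 1) * i - 1 = N + i - 1 := by
    rw [hn, add_mul, Nat.add_sub_cancel]; omega
  have e2 : n - (c + 1) * i = N := by rw [hn]; omega
  have e3 : n + m - (d + (c + 1)) * i = N + U := by rw [hn, hm, add_mul d]; omega
  rw [formulaTerm, e1, e2, e3, hn, hm]
  push_cast
  congr 4
  ring

lemma choose_core (N U : ℕ) :
    ((N + 1 : ℕ) : ℚ) * (Nat.choose (N + 1 + (U + 1)) (N + 1)) =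
      (N + U + 2) * Nat.choose (N + (U + 1)) N ∧
    ((N + 1 : ℕ) : ℚ) * (Nat.choose (N + 1 + U) (N + 1)) =
      (U + 1) * Nat.choose (N + (U + 1)) N := by
  constructor
  · have := Nat.add_one_mul_choose_eq (N + (U + 1)) N
    rw [show N + 1 + (U + 1) = N + (U + 1) + 1 by ring]
    have h : (((N + (U + 1) + 1) * (N + (U + 1)).choose N : ℕ) : ℚ) = _ := congrArg _ this
    push_cast at h ⊢
    linarith
  · have := Nat.choose_succ_right_eq (N + (U + 1)) N
    rw [show N + (U + 1) - N = U + 1 by omega] at this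
    rw [show N + 1 + U = N + (U + 1) by ring]
    have h : (((N + (U + 1)).choose (N + 1) * (N + 1) : ℕ) : ℚ) = _ := congrArg _ this
    push_cast at h ⊢
    linarith

/-- The recurrence satisfied by the summands, for `i = 0`. -/
lemma formulaTerm_zero_recurrence (c d N U : ℕ) :
    formulaTerm (c + 1) d (N + 1) (U + 1) 0 - formulaTerm (c + 1) d (N + 1) U 0 =
      formulaTerm (c + 1) d N (U + 1) 0 := by
  rw [formulaTerm_eq c d (N + 1) (U + 1) 0 _ _ (by simp) (by simp),
    formulaTerm_eq c d (N + 1) U 0 _ _ (by simp) (by simp),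
    formulaTerm_eq c d N (U + 1) 0 _ _ (by simp) (by simp)]
  obtain ⟨h1, h2⟩ := choose_core N U
  set X : ℚ := (Nat.choose (N + (U + 1)) N : ℚ)
  have hN : ((N + 1 : ℕ) : ℚ) ≠ 0 := by positivity
  rw [mul_comm, ← eq_div_iff hN] at h1 h2
  rw [h1, h2]
  have : (U : ℚ) + 1 ≠ 0 := by positivity
  have : (U : ℚ) + 1 + 1 ≠ 0 := by positivity
  push_cast at hN ⊢
  simp
  field_simp
  ring

lemma formulaTerm_succ_recurrence (c d N U i : ℕ) :
    formulaTerm (c + 1) d (N + 1 + (c + 1) * (i + 1)) (U + 1 + d * (i + 1)) (i + 1)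
      - formulaTerm (c + 1) d (N + 1 + (c + 1) * (i + 1)) (U + d * (i + 1)) (i + 1)
      + (formulaTerm (c + 1) d (N + 1 + (c + 1) * i) (U + 1 + d * i) i
        - formulaTerm (c + 1) d (N + 1 + (c + 1) * i) (U + d * i) i) =
      formulaTerm (c + 1) d (N + (c + 1) * (i + 1)) (U + 1 + d * (i + 1)) (i + 1) := by
  rw [formulaTerm_eq c d (N + 1) (U + 1) (i + 1) _ _ rfl rfl,
    formulaTerm_eq c d (N + 1) U (i + 1) _ _ rfl rfl,
    formulaTerm_eq c d (N + 1) (U + 1) i _ _ rfl rfl,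
    formulaTerm_eq c d (N + 1) U i _ _ rfl rfl,
    formulaTerm_eq c d N (U + 1) (i + 1) _ _ rfl rfl]
  obtain ⟨h1, h2⟩ := choose_core N U
  have h3 : (Nat.choose (N + i) i : ℚ) * (N + i + 1) =
      (i + 1) * Nat.choose (N + 1 + i) (i + 1) := by
    have := Nat.add_one_mul_choose_eq (N + i) i
    rw [show N + 1 + i = N + i + 1 by ring]
    have h : (((N + i + 1) * (N + i).choose i : ℕ) : ℚ) = _ := congrArg _ this
    push_cast at h
    linarith
  have h4 : (Nat.choose (N + i) (i + 1) : ℚ) * (N + i + 1) =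
      N * Nat.choose (N + 1 + i) (i + 1) := by
    have := Nat.choose_mul_succ_eq (N + i) (i + 1)
    rw [show N + i + 1 - (i + 1) = N by omega] at this
    rw [show N + 1 + i = N + i + 1 by ring]
    have h : (((N + i).choose (i + 1) * (N + i + 1) : ℕ) : ℚ) = _ := congrArg _ this
    push_cast at h
    linarith
  rw [show N + 1 + (i + 1) - 1 = N + 1 + i by omega, show N + 1 + i - 1 = N + i by omega,
    show N + (i + 1) - 1 = N + i by omega]
  have hNi : (N : ℚ) + i + 1 ≠ 0 := by positivity
  have hN : ((N + 1 : ℕ) : ℚ) ≠ 0 := by positivity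
  rw [mul_comm, ← eq_div_iff hN] at h1 h2
  rw [← eq_div_iff hNi] at h3 h4
  rw [h1, h2, h3, h4, pow_succ]
  set X : ℚ := (Nat.choose (N + (U + 1)) N : ℚ)
  set Y : ℚ := (Nat.choose (N + 1 + i) (i + 1) : ℚ)
  have : (U : ℚ) + 1 ≠ 0 := by positivity
  have : (U : ℚ) + 1 + 1 ≠ 0 := by positivity
  push_cast at hN ⊢
  field_simp
  ring

lemma formula_recurrence {b d n m : ℕ} (K : ℕ) (hb : 1 ≤ b) (hdb : d ≤ b) (hn : 1 ≤ n)
    (hnm : n ≤ m) :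
    formula b d (K + 1) n m - formula b d (K + 1) n (m - 1) +
      (formula b d K (n - b) (m - d) - formula b d K (n - b) (m - d - 1)) =
    ∑ i ∈ Finset.range (K + 1), if b * i < n then formulaTerm b d (n - 1) m i else 0 := by
  obtain ⟨c, rfl⟩ := Nat.exists_eq_add_of_le' hb
  simp only [formula]
  rw [Finset.sum_range_succ', Finset.sum_range_succ', Finset.sum_range_succ']
  have key : ∀ i, ((if (c + 1) * (i + 1) < n then formulaTerm (c + 1) d n m (i + 1) else 0)
      - (if (c + 1) * (i + 1) < n then formulaTerm (c + 1) d n (m - 1) (i + 1) else 0))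
      + ((if (c + 1) * i < n - (c + 1) then
          formulaTerm (c + 1) d (n - (c + 1)) (m - d) i else 0)
        - (if (c + 1) * i < n - (c + 1) then
          formulaTerm (c + 1) d (n - (c + 1)) (m - d - 1) i else 0))
      = if (c + 1) * (i + 1) < n then formulaTerm (c + 1) d (n - 1) m (i + 1) else 0 := by
    intro i
    have hiff : (c + 1) * i < n - (c + 1) ↔ (c + 1) * (i + 1) < n := by
      rw [mul_add, mul_one]; omega
    simp only [hiff]
    split_ifs with h
    · have hdi : d * (i + 1) ≤ (c + 1) * (i + 1) := Nat.mul_le_mul_right _ hdb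
      obtain ⟨N, rfl⟩ : ∃ N, n = N + 1 + (c + 1) * (i + 1) :=
        ⟨n - 1 - (c + 1) * (i + 1), by omega⟩
      obtain ⟨U, rfl⟩ : ∃ U, m = U + 1 + d * (i + 1) := ⟨m - 1 - d * (i + 1), by omega⟩
      have e1 : U + 1 + d * (i + 1) - 1 = U + d * (i + 1) := by omega
      have e2 : N + 1 + (c + 1) * (i + 1) - (c + 1) = N + 1 + (c + 1) * i := by
        rw [mul_add, mul_one]; omega
      have e3 : U + 1 + d * (i + 1) - d = U + 1 + d * i := by rw [mul_add, mul_one]; omega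
      have e4 : U + 1 + d * i - 1 = U + d * i := by omega
      have e5 : N + 1 + (c + 1) * (i + 1) - 1 = N + (c + 1) * (i + 1) := by omega
      rw [e1, e2, e3, e4, e5, formulaTerm_succ_recurrence]
    · simp
  have hz : formulaTerm (c + 1) d n m 0 - formulaTerm (c + 1) d n (m - 1) 0 =
      formulaTerm (c + 1) d (n - 1) m 0 := by
    obtain ⟨N, rfl⟩ := Nat.exists_eq_add_of_le' hn
    obtain ⟨U, rfl⟩ := Nat.exists_eq_add_of_le' (hn.trans hnm)
    exact formulaTerm_zero_recurrence c d N U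
  rw [← Finset.sum_congr rfl fun i _ => key i]
  simp only [Finset.sum_add_distrib, Finset.sum_sub_distrib, mul_zero, show 0 < n from hn, if_true]
  rw [← hz]
  ring

lemma formulaTerm_eq_zero (b d m i : ℕ) : formulaTerm b d (m + 1) m i = 0 := by
  simp [formulaTerm]

lemma formula_eq_zero (b d K m : ℕ) : formula b d K (m + 1) m = 0 := by
  simp [formula, formulaTerm_eq_zero]

/-- For `1 ≤ n`, the summands with `n = b * i` vanish. -/
lemma sum_le_eq_formula {b : ℕ} (d K : ℕ) {n : ℕ} (m : ℕ) (hb : 1 ≤ b) (hn : 1 ≤ n) :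
    (∑ i ∈ Finset.range K, if b * i < n + 1 then formulaTerm b d n m i else 0) =
      formula b d K n m := by
  refine Finset.sum_congr rfl fun i _ => ?_
  by_cases h : b * i = n
  · have hi : 1 ≤ i := by
      rcases Nat.eq_zero_or_pos i with rfl | hi
      · simp at h; omega
      · exact hi
    rw [if_pos (by omega), if_neg (by omega), formulaTerm, Nat.choose_eq_zero_of_lt]
    · simp
    · rw [Nat.sub_mul, h, one_mul]
      have := Nat.le_mul_of_pos_left i hb
      omega
  · simp only [show b * i < n + 1 ↔ b * i < n by omega]

lemma sum_le_zero_eq_one {b : ℕ} (d K m : ℕ) (hb : 1 ≤ b) :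
    (∑ i ∈ Finset.range (K + 1), if b * i < 0 + 1 then formulaTerm b d 0 m i else 0) = 1 := by
  rw [Finset.sum_range_succ', Finset.sum_eq_zero]
  · have : (m : ℚ) + 1 ≠ 0 := by positivity
    simp [formulaTerm, this]
  · intro i _
    rw [if_neg]
    have : 0 < b * (i + 1) := Nat.mul_pos hb (Nat.succ_pos i)
    omega

theorem s_eq_formula {p q : Word} {b d : ℕ} (hform : p = Step.r :: (q ++ [Step.r]))
    (hdz : DepthZero p) (huniq : ∀ o : Word, IsBifix o p → o = [Step.r])
    (hdimR : countR p = b + 1) (hdimU : countU p = d) (hb : 1 ≤ b) (n m K : ℕ) (hn : 1 ≤ n)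
    (hnm : n ≤ m + 1) (hK : n ≤ K) : (s p n m : ℚ) = formula b d K n m := by
  have hdb : d ≤ b := by
    have h := hdz (q ++ [Step.r]) ⟨[Step.r], by rw [hform]; simp⟩
    simp [hform, countR, countU, dval] at h hdimR hdimU
    omega
  induction n using Nat.strong_induction_on generalizing m K with
  | _ n ih =>
  have hprev : ∀ m K, n ≤ m → n ≤ K → (s p ((n : ℤ) - 1) m : ℚ) =
      ∑ i ∈ Finset.range K, if b * i < n then formulaTerm b d (n - 1) m i else 0 := by
    intro m K hm hK
    obtain ⟨n, rfl⟩ := Nat.exists_eq_add_of_le' hn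
    rcases Nat.eq_zero_or_pos n with rfl | hn'
    · obtain ⟨K, rfl⟩ := Nat.exists_eq_add_of_le' hK
      have := s_zero_left (p := p) (by omega) m
      simp only [Nat.add_sub_cancel, sum_le_zero_eq_one d K m hb]
      simpa using this
    · simp only [Nat.add_sub_cancel, sum_le_eq_formula d K m hb hn']
      rw [← ih n (by omega) m K hn' (by omega) (by omega)]
      simp
  induction m with
  | zero =>
    obtain rfl : n = 0 + 1 := by omega
    rw [formula_eq_zero, s_eq_zero_of_lt _ (by simp), Nat.cast_zero]
  | succ m ihm =>
    rcases Nat.eq_or_lt_of_le hnm with rfl | hlt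
    · rw [formula_eq_zero, s_eq_zero_of_lt _ (by simp), Nat.cast_zero]
    have hnm' : (n : ℤ) ≤ ((m + 1 : ℕ) : ℤ) := by omega
    have h1 := s_eq_add_ncard_ballotAvoidingR hform (n := n) (m := ((m + 1 : ℕ) : ℤ))
      (by omega) hnm'
    have h2 := s_eq_ncard_ballotAvoidingR_add hform hdz huniq hdimR hdimU hnm'
    have h3 : ((ballotAvoidingR p ((n : ℤ) - b) (((m + 1 : ℕ) : ℤ) - d)).ncard : ℚ) =
        formula b d (K - 1) (n - b) (m + 1 - d) - formula b d (K - 1) (n - b) (m + 1 - d - 1) := by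
      rcases Nat.lt_or_ge b n with hbn | hbn
      · have h := s_eq_add_ncard_ballotAvoidingR hform (n := ((n - b : ℕ) : ℤ))
          (m := ((m + 1 - d : ℕ) : ℤ)) (by omega) (by omega)
        rw [show ((m + 1 - d : ℕ) : ℤ) - 1 = ((m + 1 - d - 1 : ℕ) : ℤ) by omega] at h
        rw [← ih (n - b) (by omega) _ _ (by omega) (by omega) (by omega),
          ← ih (n - b) (by omega) _ _ (by omega) (by omega) (by omega), h,
          show ((n - b : ℕ) : ℤ) = n - b by omega,
          show ((m + 1 - d : ℕ) : ℤ) = ((m + 1 : ℕ) : ℤ) - d by omega]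
        push_cast
        ring
      · rw [ballotAvoidingR_eq_empty _ (by omega), Nat.sub_eq_zero_of_le hbn]
        simp [formula]
    have hrec := formula_recurrence (d := d) (m := m + 1) (K - 1) hb hdb hn (by omega)
    rw [Nat.sub_add_cancel (hn.trans hK), ← hprev (m + 1) K (by omega) hK, ← h3,
      Nat.add_sub_cancel, ← ihm (by omega), h2] at hrec
    rw [h1, show ((m + 1 : ℕ) : ℤ) - 1 = m by simp]
    push_cast at hrec ⊢
    linarith

/-- The number of Dyck paths of semilength `n ≥ 1` avoiding a depth-zero pattern
`p = r q r` whose only bifix is the single letter `r`, with dimensions `(b+1) × d`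
(`b ≥ 1`):
`s p n n = ∑_{i ≥ 0, bi ≤ n-1} (-1)^i/(n-di+1) C(n-(b-1)i-1, i) C(2n-(d+b)i, n-bi)`. -/
theorem dyck_avoiding_rqr_formula (p q : Word) (b d : ℕ)
    (hform : p = Step.r :: (q ++ [Step.r]))
    (hdz : DepthZero p)
    (hbifix : IsBifix [Step.r] p)
    (huniq : ∀ o : Word, IsBifix o p → o = [Step.r])
    (hdimR : countR p = b + 1) (hdimU : countU p = d) (hb : 1 ≤ b)
    (n : ℕ) (hn : 1 ≤ n) :
    (s p n n : ℚ) =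
      ∑ i ∈ Finset.filter (fun i => b * i ≤ n - 1) (Finset.range n),
        (-1 : ℚ) ^ i * (1 / ((n : ℚ) - d * i + 1)) *
          (Nat.choose (n - (b - 1) * i - 1) i : ℚ) *
          (Nat.choose (2 * n - (d + b) * i) (n - b * i) : ℚ) := by
  rw [s_eq_formula hform hdz huniq hdimR hdimU hb n n n hn (by omega) le_rfl, formula,
    Finset.sum_filter]
  refine Finset.sum_congr rfl fun i _ => ?_
  simp only [show b * i ≤ n - 1 ↔ b * i < n by omega, formulaTerm, sub_self, zero_add, two_mul]
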